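/- Let f : ℝ → ℝ be given by f(x) = √|x|. Then there is no error bifunction e : ℝ × ℝ → ℝ ∪ {+∞} with ℝ × ℝ ⊆ dom e for which f is e-convex. Equivalently, for every x ≠ 0, sup_{t ∈ (0,1)} ( f(tx) − t f(x) ) / ( t(1−t) ) = +∞. -/

import Mathlib

/- Setting: real-valued functions on ℝ. Since the error bifunctions considered
here satisfy `ℝ × ℝ ⊆ dom e`, they are modeled as real-valued maps
`e : ℝ → ℝ → ℝ` that are nonnegative and symmetric. -/

noncomputable section

/-- `e` is a (finite-valued) error bifunction: nonnegative and symmetric. -/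
def IsErrorBifunR (e : ℝ → ℝ → ℝ) : Prop :=
  (∀ x y, 0 ≤ e x y) ∧ (∀ x y, e x y = e y x)

/-- `f : ℝ → ℝ` is `e`-convex. -/
def EConvexR (e : ℝ → ℝ → ℝ) (f : ℝ → ℝ) : Prop :=
  ∀ x y : ℝ, ∀ t ∈ Set.Ioo (0:ℝ) 1,
    f (t * x + (1 - t) * y) ≤ t * f x + (1 - t) * f y + t * (1 - t) * e x y

/-- `f : ℝ → ℝ` is `e`-quasiconvex. -/
def EQuasiconvexR (e : ℝ → ℝ → ℝ) (f : ℝ → ℝ) : Prop :=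
  ∀ x y : ℝ, ∀ t ∈ Set.Ioo (0:ℝ) 1,
    f (t * x + (1 - t) * y) ≤ max (f x) (f y) + t * (1 - t) * e x y

/-- The quotients `(√|t x| - t √|x|) / (t (1 - t))` are unbounded above on `(0, 1)`. -/
theorem exists_lt_sqrt_abs_quotient {x : ℝ} (hx : x ≠ 0) (M : ℝ) :
    ∃ t ∈ Set.Ioo (0:ℝ) 1, M < (√|t * x| - t * √|x|) / (t * (1 - t)) := by
  have hr : 0 < √|x| := Real.sqrt_pos.mpr (abs_pos.mpr hx)
  set r := √|x|
  have hD : 0 < r + 2 * |M| + 1 := by positivity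
  obtain ⟨s, hs_def⟩ : ∃ s, s = r / (r + 2 * |M| + 1) := ⟨_, rfl⟩
  have hs0 : 0 < s := hs_def ▸ div_pos hr hD
  have hs1 : s < 1 := by
    rw [hs_def, div_lt_one hD]
    linarith [abs_nonneg M]
  have hsr : s * (r + 2 * |M| + 1) = r := by
    rw [hs_def, div_mul_cancel₀ _ hD.ne']
  have hsq1 : s ^ 2 < 1 := by nlinarith
  refine ⟨s ^ 2, ⟨by positivity, hsq1⟩, ?_⟩
  have hsqrt : √|s ^ 2 * x| = s * r := by
    rw [abs_mul, abs_of_nonneg (sq_nonneg s), Real.sqrt_mul (sq_nonneg s),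
      Real.sqrt_sq hs0.le]
  have hquot : (s * r - s ^ 2 * r) / (s ^ 2 * (1 - s ^ 2)) = r / (s * (1 + s)) := by
    have hne : 1 - s ^ 2 ≠ 0 := by linarith
    rw [div_eq_div_iff (by positivity) (by positivity)]
    ring
  rw [hsqrt, hquot, lt_div_iff₀ (by positivity)]
  calc M * (s * (1 + s)) ≤ |M| * (s * 2) := by
        gcongr
        · exact le_abs_self M
        · linarith
    _ < r := by nlinarith [mul_pos hs0 hr]

/-- `f(x) = √|x|` is not `e`-convex for any error bifunction `e`
with `ℝ × ℝ ⊆ dom e`; equivalently, for every `x ≠ 0`,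
`sup_{t ∈ (0,1)} (f(tx) − t f(x)) / (t(1−t)) = +∞`. -/
theorem stmt16 :
    (¬ ∃ e : ℝ → ℝ → ℝ, IsErrorBifunR e ∧
      EConvexR e (fun x => Real.sqrt |x|)) ∧
    (∀ x : ℝ, x ≠ 0 →
      (⨆ t : Set.Ioo (0:ℝ) 1,
        (((Real.sqrt |t.1 * x| - t.1 * Real.sqrt |x|) / (t.1 * (1 - t.1)) : ℝ) : EReal))
        = ⊤) := by
  refine ⟨?_, fun x hx => ?_⟩
  · rintro ⟨e, -, he⟩
    obtain ⟨t, ht, hlt⟩ := exists_lt_sqrt_abs_quotient one_ne_zero (e 1 0)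
    rw [lt_div_iff₀ (mul_pos ht.1 (sub_pos.mpr ht.2))] at hlt
    have h := he 1 0 t ht
    simp only [mul_zero, add_zero, abs_zero, Real.sqrt_zero] at h
    linarith
  · rw [EReal.eq_top_iff_forall_lt]
    intro M
    obtain ⟨t, ht, hlt⟩ := exists_lt_sqrt_abs_quotient hx M
    exact lt_iSup_iff.mpr ⟨⟨t, ht⟩, EReal.coe_lt_coe_iff.mpr hlt⟩
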